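/- arXiv:1308.0747 — 2 statements merged into one kernel-verified Lean document; each statement's English description precedes it below -/
import Mathlib

section
/- Let n ≥ 1, let O be a valuation δ-subring of R whose residue field O/pO is finite, let u₀ ∈ GL_n(R) and α be an n×n matrix, both with all entries in O, and let u ∈ GL_n(R) be the unique matrix with u ≡ u₀ mod p and φ(u) = (1+pα)·u^(p). Then there exists a δ-subring O' of R with O ⊆ O' such that all entries of u lie in O' and the extension O ⊆ O' is generically finite, i.e., the subfield of K generated by O' is a finite field extension of the subfield of K generated by O. -/
noncomputable section

open Matrix

/-- `R = W(k)`, `k` the algebraic closure of `𝔽_p`. -/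
abbrev Rp (p : ℕ) [Fact p.Prime] : Type _ :=
  WittVector p (AlgebraicClosure (ZMod p))

/-- `φ`, the unique Frobenius lift on `R`. -/
abbrev frobW (p : ℕ) [Fact p.Prime] : Rp p →+* Rp p :=
  WittVector.frobenius

/-- `K`, the fraction field of `R`. -/
abbrev Kp (p : ℕ) [Fact p.Prime] : Type _ := FractionRing (Rp p)

section IntegralElements

/-- If `S` is a finite subset of a field whose elements have their `m`-th powers (`1 < m`) in the
linear span of `S` over a subfield `F`, then all elements of `S` are integral over `F`. -/
theorem isIntegral_of_pow_mem_span {K : Type*} [Field K] {F : Subfield K} {S : Set K}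
    (hS : S.Finite) {m : ℕ} (hm : 1 < m) (h : ∀ s ∈ S, s ^ m ∈ Submodule.span F S)
    {s : K} (hs : s ∈ S) : IsIntegral F s := by
  suffices H : s ∈ (integralClosure (Subring.closure (F : Set K)) K).toSubring by
    have H' : IsIntegral (Subring.closure (F : Set K)) s := H
    have e : Subring.closure (F : Set K) ≤ F.toSubring := Subring.closure_le.2 fun x hx => hx
    obtain ⟨q, hq, hq'⟩ := H'
    refine ⟨q.map (Subring.inclusion e), hq.map _, ?_⟩
    rw [Polynomial.eval₂_map]
    exact hq'
  rw [← iInf_valuationSubring_superset, Subring.mem_iInf]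
  rintro ⟨V, hV⟩
  obtain ⟨t, htS, ht⟩ := hS.exists_maximalFor V.valuation S ⟨s, hs⟩
  have hmax : ∀ x ∈ S, V.valuation x ≤ V.valuation t := fun x hx =>
    (le_total (V.valuation x) (V.valuation t)).elim id fun h' => ht hx h'
  have hspan : ∀ x ∈ Submodule.span F S, V.valuation x ≤ V.valuation t := by
    intro x hx
    induction hx using Submodule.span_induction with
    | mem x hx => exact hmax x hx
    | zero => simp
    | add x y _ _ hx hy => exact V.valuation.map_add_le hx hy
    | smul c x _ hx =>
      have hc : V.valuation (c : K) ≤ 1 := (V.valuation_le_one_iff _).2 (hV c.2)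
      rw [Subfield.smul_def, smul_eq_mul, map_mul]
      exact mul_le_of_le_one_of_le hc hx
  have ht1 : V.valuation t ≤ 1 := by
    by_contra! hlt
    have h1 := hspan _ (h t htS)
    rw [map_pow] at h1
    exact absurd h1 (not_le.2 (lt_self_pow₀ hlt hm))
  exact (V.valuation_le_one_iff _).1 ((hmax s hs).trans ht1)

end IntegralElements

section Congruences

theorem pow_succ_dvd_pow_sub_pow {A : Type*} [CommRing A] {p m : ℕ} {a b : A}
    (h : (p : A) ^ (m + 1) ∣ a - b) : (p : A) ^ (m + 2) ∣ a ^ p - b ^ p := by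
  have hp : (p : A) ∣ ∑ i ∈ Finset.range p, a ^ i * b ^ (p - 1 - i) := by
    have hab : (p : A) ∣ a - b := (dvd_pow_self _ m.succ_ne_zero).trans h
    exact dvd_geom_sum₂_self hab
  rw [← (Commute.all a b).geom_sum₂_mul, pow_succ' _ (m + 1)]
  exact mul_dvd_mul hp h

end Congruences

section WittVectors

variable {p : ℕ} [Fact p.Prime]

theorem p_dvd_iff_constantCoeff_eq_zero (x : Rp p) :
    (p : Rp p) ∣ x ↔ WittVector.constantCoeff x = 0 := by
  rw [← Ideal.mem_span_singleton, WittVector.mem_span_p_iff_coeff_zero_eq_zero,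
    WittVector.constantCoeff_apply]

theorem p_dvd_sub_iff (x y : Rp p) : (p : Rp p) ∣ x - y ↔
    (WittVector.constantCoeff x : AlgebraicClosure (ZMod p)) = WittVector.constantCoeff y := by
  rw [p_dvd_iff_constantCoeff_eq_zero, map_sub, sub_eq_zero]

theorem eq_of_forall_p_pow_dvd_sub {x y : Rp p} (h : ∀ m : ℕ, (p : Rp p) ^ (m + 1) ∣ x - y) :
    x = y := by
  by_contra hne
  obtain ⟨m, hm⟩ := FiniteMultiplicity.of_not_isUnit
    (WittVector.irreducible (k := AlgebraicClosure (ZMod p)) p).not_isUnit (sub_ne_zero.2 hne)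
  exact hm (h m)

theorem p_pow_dvd_of_dvd_frobW {m : ℕ} {x : Rp p} (h : (p : Rp p) ^ m ∣ frobW p x) :
    (p : Rp p) ^ m ∣ x := by
  obtain ⟨y, hy⟩ := h
  have hb := WittVector.frobenius_bijective p (AlgebraicClosure (ZMod p))
  obtain ⟨z, rfl⟩ := hb.2 y
  refine ⟨z, hb.1 ?_⟩
  rw [hy, map_mul, map_pow, map_natCast]

theorem constantCoeff_frobW_pow (j : ℕ) (x : Rp p) :
    (WittVector.constantCoeff ((frobW p ^ j) x) : AlgebraicClosure (ZMod p)) =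
      WittVector.constantCoeff x ^ p ^ j := by
  rw [RingHom.coe_pow, WittVector.constantCoeff_apply, WittVector.constantCoeff_apply,
    WittVector.iterate_frobenius_coeff]

theorem frobW_pow_succ_apply (j : ℕ) (x : Rp p) :
    (frobW p ^ (j + 1)) x = frobW p ((frobW p ^ j) x) := by
  rw [pow_succ']; rfl

theorem frobW_pow_apply_frobW (j : ℕ) (x : Rp p) :
    (frobW p ^ j) (frobW p x) = frobW p ((frobW p ^ j) x) := by
  rw [← frobW_pow_succ_apply, pow_succ]; rfl

/-- A solution of `φ(u) = A · u^(p)` is determined by its reduction modulo `p`. -/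
theorem eq_of_frobW_eq_mul {n : ℕ} {A u v : Matrix (Fin n) (Fin n) (Rp p)}
    (hu : u.map (frobW p) = A * u.map (· ^ p)) (hv : v.map (frobW p) = A * v.map (· ^ p))
    (h : ∀ i j, (p : Rp p) ∣ u i j - v i j) : u = v := by
  have key : ∀ m : ℕ, ∀ i j, (p : Rp p) ^ (m + 1) ∣ u i j - v i j := by
    intro m
    induction m with
    | zero => simpa using h
    | succ m ih =>
      intro i j
      apply p_pow_dvd_of_dvd_frobW
      have hui := congrFun (congrFun hu i) j
      have hvi := congrFun (congrFun hv i) j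
      rw [Matrix.map_apply, Matrix.mul_apply] at hui hvi
      rw [map_sub, hui, hvi, ← Finset.sum_sub_distrib]
      refine Finset.dvd_sum fun c _ => ?_
      rw [← mul_sub]
      exact (pow_succ_dvd_pow_sub_pow (ih c j)).mul_left _
  ext1 i j
  exact eq_of_forall_p_pow_dvd_sub fun m => key m i j

/-- Some positive iterate of Frobenius is trivial modulo `p` on a subring with finite residue
ring. -/
theorem exists_pow_eq_of_finite_quotient (O : Subring (Rp p))
    (hres : Finite ((↥O) ⧸ Ideal.span {(p : ↥O)})) :
    ∃ ν : ℕ, 0 < ν ∧ ∀ x ∈ O,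
      (WittVector.constantCoeff x : AlgebraicClosure (ZMod p)) ^ p ^ ν =
        WittVector.constantCoeff x := by
  let f : O →+* AlgebraicClosure (ZMod p) := WittVector.constantCoeff.comp O.subtype
  have hf : ∀ a ∈ Ideal.span {(p : ↥O)}, f a = 0 := by
    intro a ha
    obtain ⟨b, rfl⟩ := Ideal.mem_span_singleton.1 ha
    rw [map_mul, map_natCast, CharP.cast_eq_zero, zero_mul]
  have hfin : Finite f.range := by
    refine Set.Finite.subset (Set.finite_range (Ideal.Quotient.lift _ f hf)) ?_
    rintro _ ⟨x, rfl⟩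
    exact ⟨Ideal.Quotient.mk _ x, Ideal.Quotient.lift_mk _ _ _⟩
  have := Fintype.ofFinite f.range
  let : Field f.range := Finite.isField_of_domain f.range |>.toField
  have : CharP f.range p := inferInstance
  obtain ⟨ν, -, hν⟩ := FiniteField.card f.range p
  refine ⟨ν, ν.2, fun x hx => ?_⟩
  have := FiniteField.pow_card (⟨f ⟨x, hx⟩, ⟨x, hx⟩, rfl⟩ : f.range)
  rw [hν] at this
  exact congrArg Subtype.val this

/-- An iterate of `φ` which is the identity modulo `p` on a subring `O` closed under exact
division by `p` is the identity on `O`. -/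
theorem frobW_pow_eq_self {O : Subring (Rp p)}
    (hdiv : ∀ x : Rp p, (p : Rp p) * x ∈ O → x ∈ O) {ν : ℕ} (hν : 0 < ν)
    (hpow : ∀ x ∈ O, (WittVector.constantCoeff x : AlgebraicClosure (ZMod p)) ^ p ^ ν =
        WittVector.constantCoeff x) {x : Rp p} (hx : x ∈ O) : (frobW p ^ ν) x = x := by
  have key : ∀ m : ℕ, ∀ x ∈ O, (p : Rp p) ^ (m + 1) ∣ (frobW p ^ ν) x - x := by
    intro m
    induction m with
    | zero =>
      intro x hx
      rw [zero_add, pow_one, p_dvd_sub_iff, constantCoeff_frobW_pow, hpow x hx]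
    | succ m ih =>
      intro x hx
      obtain ⟨y, hy⟩ : (p : Rp p) ∣ x ^ p ^ ν - x := by
        rw [p_dvd_sub_iff, map_pow, hpow x hx]
      have hyO : y ∈ O := hdiv y (hy ▸ O.sub_mem (O.pow_mem hx _) hx)
      obtain ⟨ν, rfl⟩ := Nat.exists_eq_succ_of_ne_zero hν.ne'
      have h1 : (p : Rp p) ^ (m + 2) ∣
          (frobW p ^ (ν + 1)) x ^ p ^ (ν + 1) - x ^ p ^ (ν + 1) := by
        rw [pow_succ' p ν, pow_mul, pow_mul]
        exact (pow_succ_dvd_pow_sub_pow (ih x hx)).trans (sub_dvd_pow_sub_pow _ _ _)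
      have h2 : (p : Rp p) ^ (m + 2) ∣ p * ((frobW p ^ (ν + 1)) y - y) := by
        rw [pow_succ']
        exact mul_dvd_mul_left _ (ih y hyO)
      have h3 : x = x ^ p ^ (ν + 1) - p * y := by rw [← hy, sub_sub_cancel]
      have h4 : (frobW p ^ (ν + 1)) x - x =
          ((frobW p ^ (ν + 1)) x ^ p ^ (ν + 1) - x ^ p ^ (ν + 1)) -
            p * ((frobW p ^ (ν + 1)) y - y) := by
        have h5 := congrArg (frobW p ^ (ν + 1)) h3
        rw [map_sub, map_mul, map_pow, map_natCast] at h5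
        linear_combination h5 - h3
      rw [h4]
      exact dvd_sub h1 h2
  exact eq_of_forall_p_pow_dvd_sub fun m => key m x hx

/-- The endomorphism of `K` induced by `φ`. -/
def frobK (p : ℕ) [Fact p.Prime] : Kp p →+* Kp p :=
  IsFractionRing.lift (g := (algebraMap (Rp p) (Kp p)).comp (frobW p))
    ((IsFractionRing.injective (Rp p) (Kp p)).comp
      (WittVector.frobenius_bijective p (AlgebraicClosure (ZMod p))).1)

theorem frobK_algebraMap (x : Rp p) :
    frobK p (algebraMap (Rp p) (Kp p) x) = algebraMap (Rp p) (Kp p) (frobW p x) :=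
  IsFractionRing.lift_algebraMap _ x

theorem det_one_add_p_smul_ne_zero {n : ℕ} (α : Matrix (Fin n) (Fin n) (Rp p)) :
    (1 + (p : Rp p) • α).det ≠ 0 := by
  intro h
  have h1 := congrArg (WittVector.constantCoeff (p := p)) h
  rw [RingHom.map_det, map_zero, map_add, map_one] at h1
  have h2 : (WittVector.constantCoeff (p := p) (R := AlgebraicClosure (ZMod p))).mapMatrix
      ((p : Rp p) • α) = 0 := by
    ext1 i j
    exact (p_dvd_iff_constantCoeff_eq_zero _).1 (Dvd.intro _ rfl)
  rw [h2, add_zero, Matrix.det_one] at h1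
  exact one_ne_zero h1

theorem det_mem_subring {A ι : Type*} [CommRing A] [Fintype ι] [DecidableEq ι] {O : Subring A}
    {M : Matrix ι ι A} (h : ∀ i j, M i j ∈ O) : M.det ∈ O := by
  rw [Matrix.det_apply]
  exact O.sum_mem fun σ _ => by
    rw [Units.smul_def]
    exact O.zsmul_mem (O.prod_mem fun i _ => h _ _) _

theorem adjugate_mem_subring {A ι : Type*} [CommRing A] [Fintype ι] [DecidableEq ι]
    {O : Subring A} {M : Matrix ι ι A} (h : ∀ i j, M i j ∈ O) (i j : ι) :
    M.adjugate i j ∈ O := by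
  rw [Matrix.adjugate_apply]
  refine det_mem_subring fun a b => ?_
  rw [Matrix.updateRow_apply, Pi.single_apply]
  split_ifs
  exacts [O.one_mem, O.zero_mem, h a b]

/-- The entries of all `φ`-iterates of `u`, viewed in `K`. -/
def frobeniusOrbit {n : ℕ} (u : Matrix (Fin n) (Fin n) (Rp p)) : Set (Kp p) :=
  {x | ∃ m i j, algebraMap (Rp p) (Kp p) ((frobW p ^ m) (u i j)) = x}

theorem frobeniusOrbit_finite {n : ℕ} {u : Matrix (Fin n) (Fin n) (Rp p)} {ν : ℕ} (hν : 0 < ν)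
    (h : ∀ i j, (frobW p ^ ν) (u i j) = u i j) : (frobeniusOrbit u).Finite := by
  refine (Set.finite_range fun t : Fin ν × Fin n × Fin n =>
    algebraMap (Rp p) (Kp p) ((frobW p ^ (t.1 : ℕ)) (u t.2.1 t.2.2))).subset ?_
  rintro _ ⟨m, i, j, rfl⟩
  refine ⟨(⟨m % ν, Nat.mod_lt _ hν⟩, i, j), ?_⟩
  have hper : Function.IsPeriodicPt (frobW p) ν (u i j) := by
    rw [Function.IsPeriodicPt, Function.IsFixedPt, ← RingHom.coe_pow, h]
  simp only [RingHom.coe_pow, hper.iterate_mod_apply]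

/-- The `p`-th powers of the elements of the orbit are linear combinations of its elements. -/
theorem pow_mem_span_frobeniusOrbit {n : ℕ} {O : Subring (Rp p)}
    (hφ : ∀ x ∈ O, frobW p x ∈ O) {A u : Matrix (Fin n) (Fin n) (Rp p)} (hA : ∀ i j, A i j ∈ O)
    (hdet : A.det ≠ 0) (heq : u.map (frobW p) = A * u.map (· ^ p))
    {x : Kp p} (hx : x ∈ frobeniusOrbit u) :
    x ^ p ∈ Submodule.span (Subfield.closure (algebraMap (Rp p) (Kp p) '' O))
      (frobeniusOrbit u) := by
  have hφm : ∀ (m : ℕ), ∀ x ∈ O, (frobW p ^ m) x ∈ O := by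
    intro m x hx
    induction m with
    | zero => exact hx
    | succ m ih => rw [frobW_pow_succ_apply]; exact hφ _ ih
  obtain ⟨m, i, j, rfl⟩ := hx
  have h1 : A.adjugate * u.map (frobW p) = A.det • u.map (· ^ p) := by
    rw [heq, ← Matrix.mul_assoc, Matrix.adjugate_mul, Matrix.smul_mul, Matrix.one_mul]
  have h2 := congrArg (frobW p ^ m) (congrFun (congrFun h1 i) j)
  rw [Matrix.mul_apply, Matrix.smul_apply, smul_eq_mul, map_mul, map_sum] at h2
  simp only [Matrix.map_apply, map_mul, map_pow, frobW_pow_apply_frobW,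
    ← frobW_pow_succ_apply] at h2
  have h3 := congrArg (algebraMap (Rp p) (Kp p)) h2
  simp only [map_sum, map_mul, map_pow] at h3
  set F := Subfield.closure (algebraMap (Rp p) (Kp p) '' O)
  have hF : ∀ x ∈ O, algebraMap (Rp p) (Kp p) x ∈ F := fun x hx =>
    Subfield.subset_closure ⟨x, hx, rfl⟩
  have hne : algebraMap (Rp p) (Kp p) ((frobW p ^ m) A.det) ≠ 0 := by
    rw [RingHom.coe_pow]
    have hinj := (WittVector.frobenius_bijective p (AlgebraicClosure (ZMod p))).1.iterate m
    intro h0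
    have h0' := (map_eq_zero_iff _ (IsFractionRing.injective (Rp p) (Kp p))).1 h0
    exact hdet (hinj (h0'.trans (iterate_map_zero _ _).symm))
  let d : F := ⟨_, hF _ (hφm m _ (det_mem_subring hA))⟩
  have hd : d ≠ 0 := fun h => hne (congrArg Subtype.val h)
  refine ((Submodule.span F (frobeniusOrbit u)).smul_mem_iff hd).1 ?_
  rw [Subfield.smul_def, smul_eq_mul, ← h3]
  refine Submodule.sum_mem _ fun c _ => ?_
  exact Submodule.smul_mem _ (⟨_, hF _ (hφm m _ (adjugate_mem_subring hA i c))⟩ : F)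
    (Submodule.subset_span ⟨m + 1, c, j, rfl⟩)

end WittVectors

/-- for `Δ = 0` and `u₀, α` with entries in a valuation `δ`-subring `O`
of `R` with finite residue field, the solution `u` has entries in a `δ`-subring `O'`
of `R` which is generically finite over `O`. -/
theorem statement6 {p : ℕ} [Fact p.Prime] (hp2 : p ≠ 2)
    (δ : Rp p → Rp p) (hδ : ∀ a, frobW p a = a ^ p + p * δ a)
    (n : ℕ) (hn : 1 ≤ n)
    (O : Subring (Rp p))
    (hOδ : ∀ x ∈ O, δ x ∈ O)
    (hOval : ∃ F : Subfield (Kp p),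
      O = (F.toSubring).comap (algebraMap (Rp p) (Kp p)))
    (hres : Finite ((↥O) ⧸ Ideal.span {(p : ↥O)}))
    (u₀ : Matrix (Fin n) (Fin n) (Rp p)) (hu₀ : IsUnit u₀)
    (hu₀O : ∀ i j, u₀ i j ∈ O)
    (α : Matrix (Fin n) (Fin n) (Rp p)) (hαO : ∀ i j, α i j ∈ O)
    (u : Matrix (Fin n) (Fin n) (Rp p)) (hu : IsUnit u)
    (hcong : ∀ i j, (p : Rp p) ∣ (u i j - u₀ i j))
    (heq : u.map (frobW p) = (1 + (p : Rp p) • α) * u.map (· ^ p)) :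
    ∃ O' : Subring (Rp p), O ≤ O' ∧ (∀ x ∈ O', δ x ∈ O') ∧ (∀ i j, u i j ∈ O') ∧
      Subfield.closure (algebraMap (Rp p) (Kp p) '' O) ≤
        Subfield.closure (algebraMap (Rp p) (Kp p) '' O') ∧
      ∃ s : Finset (Kp p),
        (Subfield.closure (algebraMap (Rp p) (Kp p) '' O') : Set (Kp p)) ⊆
          (Submodule.span (Subfield.closure (algebraMap (Rp p) (Kp p) '' O))
            (s : Set (Kp p)) : Set (Kp p)) := by
  obtain ⟨F, hF⟩ := hOval
  have hp0 : (p : Kp p) ≠ 0 := WittVector.FractionRing.p_nonzero p _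
  have hφ : ∀ x ∈ O, frobW p x ∈ O := fun x hx => by
    rw [hδ]
    exact O.add_mem (O.pow_mem hx _) (O.mul_mem (natCast_mem O p) (hOδ x hx))
  have hdiv : ∀ x : Rp p, (p : Rp p) * x ∈ O → x ∈ O := by
    intro x hx
    rw [hF] at hx ⊢
    have h1 : algebraMap (Rp p) (Kp p) (p * x) ∈ F := hx
    rw [map_mul, map_natCast] at h1
    have h2 := F.mul_mem (F.inv_mem (natCast_mem F p)) h1
    rw [inv_mul_cancel_left₀ hp0] at h2
    exact h2
  obtain ⟨ν, hν, hpow⟩ := exists_pow_eq_of_finite_quotient O hres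
  set A := 1 + (p : Rp p) • α with hAdef
  have hAO : ∀ i j, A i j ∈ O := by
    intro i j
    rw [hAdef, Matrix.add_apply, Matrix.smul_apply, smul_eq_mul, Matrix.one_apply]
    refine O.add_mem ?_ (O.mul_mem (natCast_mem O p) (hαO i j))
    split_ifs
    exacts [O.one_mem, O.zero_mem]
  have hfix : ∀ i j, (frobW p ^ ν) (u i j) = u i j := by
    have hv : (u.map (frobW p ^ ν)).map (frobW p) = A * (u.map (frobW p ^ ν)).map (· ^ p) := by
      ext1 i j
      have h1 := congrArg (frobW p ^ ν) (congrFun (congrFun heq i) j)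
      simp only [Matrix.map_apply, Matrix.mul_apply, map_sum, map_mul, map_pow,
        frobW_pow_apply_frobW] at h1 ⊢
      rw [h1]
      exact Finset.sum_congr rfl fun c _ => by rw [frobW_pow_eq_self hdiv hν hpow (hAO i c)]
    have h := eq_of_frobW_eq_mul hv heq fun i j => by
      rw [Matrix.map_apply, p_dvd_sub_iff, constantCoeff_frobW_pow,
        (p_dvd_sub_iff _ _).1 (hcong i j), hpow _ (hu₀O i j)]
    exact fun i j => congrFun (congrFun h i) j
  set S := frobeniusOrbit u
  have hSfin : S.Finite := frobeniusOrbit_finite hν hfix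
  set E := Subfield.closure (algebraMap (Rp p) (Kp p) '' O)
  have hint : ∀ x ∈ S, IsIntegral E x := fun x hx =>
    isIntegral_of_pow_mem_span hSfin (Fact.out : p.Prime).one_lt
      (fun y hy => pow_mem_span_frobeniusOrbit hφ hAO (det_one_add_p_smul_ne_zero α) heq hy) hx
  have : Finite S := hSfin
  have hfd : FiniteDimensional E (IntermediateField.adjoin E S) :=
    IntermediateField.finiteDimensional_adjoin hint
  let L : Subfield (Kp p) := Subfield.closure (algebraMap (Rp p) (Kp p) '' O ∪ S)
  have hLφ : L ≤ L.comap (frobK p) := by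
    refine Subfield.closure_le.2 ?_
    rintro _ (⟨x, hx, rfl⟩ | ⟨m, i, j, rfl⟩)
    · refine Subfield.subset_closure (Or.inl ⟨frobW p x, hφ x hx, ?_⟩)
      rw [frobK_algebraMap]
    · refine Subfield.subset_closure (Or.inr ⟨m + 1, i, j, ?_⟩)
      rw [frobK_algebraMap, frobW_pow_succ_apply]
  have hOO' : O ≤ L.toSubring.comap (algebraMap (Rp p) (Kp p)) := fun x hx =>
    Subfield.subset_closure (Or.inl ⟨x, hx, rfl⟩)
  refine ⟨L.toSubring.comap (algebraMap (Rp p) (Kp p)), hOO', fun x hx => ?_,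
    fun i j => Subfield.subset_closure (Or.inr ⟨0, i, j, rfl⟩),
    Subfield.closure_mono (Set.image_mono hOO'), ?_⟩
  · have hx' : algebraMap (Rp p) (Kp p) x ∈ L := hx
    have h1 : frobK p (algebraMap (Rp p) (Kp p) x) ∈ L := hLφ hx'
    have h2 : algebraMap (Rp p) (Kp p) (δ x) =
        (p : Kp p)⁻¹ * (frobK p (algebraMap (Rp p) (Kp p) x) -
          algebraMap (Rp p) (Kp p) x ^ p) := by
      rw [frobK_algebraMap, hδ, map_add, map_mul, map_pow, map_natCast, add_sub_cancel_left,
        inv_mul_cancel_left₀ hp0]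
    change algebraMap (Rp p) (Kp p) (δ x) ∈ L
    rw [h2]
    exact L.mul_mem (L.inv_mem (natCast_mem L p)) (L.sub_mem h1 (L.pow_mem hx' p))
  · obtain ⟨s, hs⟩ : (IntermediateField.adjoin E S).toSubalgebra.toSubmodule.FG :=
      (Submodule.fg_iff_finiteDimensional _).2 hfd
    refine ⟨s, ?_⟩
    rw [hs]
    have hle : L ≤ (IntermediateField.adjoin E S).toSubfield := by
      refine Subfield.closure_le.2 ?_
      rintro x (hx | hx)
      · exact (IntermediateField.adjoin E S).algebraMap_mem ⟨x, Subfield.subset_closure hx⟩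
      · exact IntermediateField.subset_adjoin E S hx
    refine Set.Subset.trans (SetLike.coe_subset_coe.2 (Subfield.closure_le.2 ?_)) hle
    rintro _ ⟨x, hx, rfl⟩
    exact hx
end
end

section
/- Let n ≥ 1 and let X = {u ∈ GL_n(R) : u ≡ 1 mod p}, a topological subspace of the space of n×n matrices over R with the p-adic topology. There exists a meagre subset Ω of X such that for every u ∈ X \ Ω the following holds: setting α := δu·(u^(p))⁻¹ (the matrix u^(p) is invertible), there exists a valuation δ-subring O of R containing R^δ and all entries of α such that G_{u/O} = N^δ, i.e., the δ-Galois group of u over O consists exactly of the monomial matrices whose nonzero entries lie in R^δ. -/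
set_option synthInstance.maxHeartbeats 1000000
set_option maxHeartbeats 1000000

noncomputable section

open Matrix

/-- The `p`-adic topology on `R`. -/
instance RpTop (p : ℕ) [Fact p.Prime] : TopologicalSpace (Rp p) :=
  (Ideal.span {(p : Rp p)}).adicTopology

/-- `O[u]`, the subring of `R` generated by `O` and the entries of `u`. -/
def genBy {p : ℕ} [Fact p.Prime] {n : ℕ} (O : Subring (Rp p))
    (u : Matrix (Fin n) (Fin n) (Rp p)) : Subring (Rp p) :=
  Subring.closure ((O : Set (Rp p)) ∪ {x | ∃ i j, u i j = x})

lemma mem_genBy {p : ℕ} [Fact p.Prime] {n : ℕ} (O : Subring (Rp p))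
    (u : Matrix (Fin n) (Fin n) (Rp p)) (i j : Fin n) : u i j ∈ genBy O u :=
  Subring.subset_closure (Or.inr ⟨i, j, rfl⟩)

/-- The `δ`-Galois group `G_{u/O}`. -/
def galoisGroup {p : ℕ} [Fact p.Prime] (δ : Rp p → Rp p) {n : ℕ} (O : Subring (Rp p))
    (u : Matrix (Fin n) (Fin n) (Rp p)) : Set (Matrix (Fin n) (Fin n) (Rp p)) :=
  {c | (∀ i j, c i j ∈ O) ∧
    (∃ d : Matrix (Fin n) (Fin n) (Rp p),
      c * d = 1 ∧ d * c = 1 ∧ ∀ i j, d i j ∈ O) ∧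
    ∃ σ : genBy O u ≃+* genBy O u,
      (∀ x : genBy O u, (x : Rp p) ∈ O → (σ x : Rp p) = x) ∧
      (∀ x y : genBy O u, (y : Rp p) = δ (x : Rp p) →
        (σ y : Rp p) = δ (σ x : Rp p)) ∧
      (∀ i j, (σ ⟨u i j, mem_genBy O u i j⟩ : Rp p) = (u * c) i j)}

section Independence

theorem AlgebraicIndependent.of_mem_adjoin_of_card_le {R A ι κ : Type*} [CommRing R] [IsDomain R]
    [CommRing A] [IsDomain A] [Algebra R A] [FaithfulSMul R A] [Finite ι] [Finite κ]
    {x : κ → A} {y : ι → A}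
    (hx : AlgebraicIndependent R x) (hxy : ∀ k, x k ∈ Algebra.adjoin R (Set.range y))
    (hcard : Nat.card ι ≤ Nat.card κ) : AlgebraicIndependent R y := by
  set B := Algebra.adjoin R (Set.range y) with hB
  let x' : κ → B := fun k ↦ ⟨x k, hxy k⟩
  let y' : ι → B := fun i ↦ ⟨y i, Algebra.subset_adjoin ⟨i, rfl⟩⟩
  have hx' : AlgebraicIndependent R x' := AlgebraicIndependent.of_comp B.val hx
  have htop : Algebra.adjoin R (Set.range y') = ⊤ := by
    apply Subalgebra.map_injective (f := B.val) Subtype.val_injective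
    rw [AlgHom.map_adjoin, ← Set.range_comp]
    simp only [Algebra.map_top, Subalgebra.range_val]
    rfl
  have : Algebra.IsAlgebraic (Algebra.adjoin R (Set.range y')) B :=
    ⟨fun b ↦ isAlgebraic_algebraMap (⟨b, htop ▸ Algebra.mem_top⟩ :
      Algebra.adjoin R (Set.range y'))⟩
  have hle := hx'.lift_cardinalMk_le_trdeg
  have hy' := Algebra.IsAlgebraic.isTranscendenceBasis_of_lift_le_trdeg_of_finite R y' (by
    have := Fintype.ofFinite ι
    have := Fintype.ofFinite κ
    simp only [Cardinal.mk_fintype, Cardinal.lift_natCast, Nat.card_eq_fintype_card] at *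
    rw [Cardinal.nat_le_lift_iff] at hle ⊢
    exact (Nat.cast_le.mpr hcard).trans hle)
  exact hy'.1.map' (f := B.val) Subtype.val_injective

end Independence

section RFacts
variable {p : ℕ} [Fact p.Prime]

theorem Rp.p_ne_zero : (p : Rp p) ≠ 0 := WittVector.p_nonzero p _

instance Rp.instCharZero : CharZero (Rp p) := by
  obtain ⟨q, hq⟩ := CharP.exists (Rp p)
  rcases CharP.char_is_prime_or_zero (Rp p) q with h | rfl
  · have h0 : (q : AlgebraicClosure (ZMod p)) = 0 := by
      rw [← map_natCast (WittVector.constantCoeff (p := p)) q, CharP.cast_eq_zero, map_zero]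
    rw [CharP.cast_eq_zero_iff _ p] at h0
    rw [← (Nat.prime_dvd_prime_iff_eq (Fact.out : p.Prime) h).1 h0] at hq
    exact absurd (CharP.cast_eq_zero (Rp p) p) Rp.p_ne_zero
  · exact CharP.charP_to_charZero _

theorem Rp.p_dvd_iff (x : Rp p) : (p : Rp p) ∣ x ↔ x.coeff 0 = 0 := by
  rw [← Ideal.mem_span_singleton, WittVector.mem_span_p_iff_coeff_zero_eq_zero]

theorem Rp.frob_injective : Function.Injective (frobW p) :=
  (WittVector.frobenius_bijective p _).1

theorem Rp.dvd_frob_iff (m : ℕ) (x : Rp p) : (p : Rp p) ^ m ∣ frobW p x ↔ (p : Rp p) ^ m ∣ x := by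
  constructor
  · rintro ⟨y, hy⟩
    obtain ⟨z, rfl⟩ := (WittVector.frobenius_bijective p (AlgebraicClosure (ZMod p))).2 y
    refine ⟨z, Rp.frob_injective ?_⟩
    rw [hy]; simp
  · rintro ⟨y, rfl⟩
    simp

theorem Rp.dvd_frob_iterate_iff (m N : ℕ) (x : Rp p) :
    (p : Rp p) ^ m ∣ (frobW p)^[N] x ↔ (p : Rp p) ^ m ∣ x := by
  induction N with
  | zero => rfl
  | succ N ih => rw [Function.iterate_succ_apply', Rp.dvd_frob_iff, ih]

theorem Rp.eq_zero_of_forall_pow_dvd (x : Rp p) (h : ∀ m, (p : Rp p) ^ m ∣ x) : x = 0 := by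
  by_contra hx
  obtain ⟨m, b, hb, rfl⟩ := WittVector.exists_eq_pow_p_mul x hx
  have := h (m + 1)
  rw [pow_succ, mul_dvd_mul_iff_left (pow_ne_zero _ Rp.p_ne_zero), Rp.p_dvd_iff] at this
  exact hb this

theorem Rp.isUnit_matrix {n : ℕ} (u : Matrix (Fin n) (Fin n) (Rp p))
    (h : ∀ i j, (p : Rp p) ∣ (u i j - (1 : Matrix (Fin n) (Fin n) (Rp p)) i j)) : IsUnit u := by
  rw [Matrix.isUnit_iff_isUnit_det]
  apply WittVector.isUnit_of_coeff_zero_ne_zero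
  have : WittVector.constantCoeff (p := p) u.det = 1 := by
    rw [RingHom.map_det]
    rw [show WittVector.constantCoeff.mapMatrix u = 1 from ?_, Matrix.det_one]
    ext i j
    have := (Rp.p_dvd_iff _).1 (h i j)
    change WittVector.constantCoeff (u i j - (1 : Matrix (Fin n) (Fin n) (Rp p)) i j) = 0 at this
    rw [map_sub, sub_eq_zero] at this
    simp only [RingHom.mapMatrix_apply, map_apply]
    rw [this]
    by_cases hij : i = j <;> simp [hij, Matrix.one_apply]
  change u.det.coeff 0 = 1 at this
  simp [this]

theorem Rp.frob_eq_iterate {x : Rp p} (hx : frobW p x = x ^ p) (N : ℕ) :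
    (frobW p)^[N] x = x ^ p ^ N := by
  induction N with
  | zero => simp
  | succ N ih => rw [Function.iterate_succ_apply', ih, map_pow, hx, ← pow_mul, pow_succ']

theorem Rp.eq_of_frob_eq_pow {x y : Rp p} (hx : frobW p x = x ^ p) (hy : frobW p y = y ^ p)
    (h : (p : Rp p) ∣ x - y) : x = y := by
  rw [← sub_eq_zero]
  apply Rp.eq_zero_of_forall_pow_dvd
  intro m
  rw [← Rp.dvd_frob_iterate_iff m m, iterate_map_sub, Rp.frob_eq_iterate hx, Rp.frob_eq_iterate hy]
  exact (pow_dvd_pow _ m.le_succ).trans (dvd_sub_pow_of_dvd_sub h m)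

theorem Rp.exists_pow_eq_self {x : Rp p} (hx : frobW p x = x ^ p) :
    ∃ N, 2 ≤ N ∧ x ^ N = x := by
  obtain ⟨N, hN, h⟩ : ∃ N, 0 < N ∧ (x.coeff 0) ^ p ^ N = x.coeff 0 := by
    set t := x.coeff 0
    have ht : IsIntegral (ZMod p) t := Algebra.IsIntegral.isIntegral t
    have := IntermediateField.adjoin.finiteDimensional ht
    have : Finite (IntermediateField.adjoin (ZMod p) {t}) := Module.finite_of_finite (ZMod p)
    have := Fintype.ofFinite (IntermediateField.adjoin (ZMod p) {t})
    obtain ⟨N, -, hN⟩ := FiniteField.card (IntermediateField.adjoin (ZMod p) {t}) p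
    refine ⟨N, N.pos, ?_⟩
    have := FiniteField.pow_card
      (⟨t, IntermediateField.mem_adjoin_simple_self _ t⟩ : IntermediateField.adjoin (ZMod p) {t})
    rw [hN] at this
    exact congrArg Subtype.val this
  have hp := (Fact.out : p.Prime).two_le
  refine ⟨p ^ N, hp.trans (Nat.le_self_pow hN.ne' p), Rp.eq_of_frob_eq_pow ?_ hx ?_⟩
  · rw [map_pow, hx, ← pow_mul, ← pow_mul, mul_comm]
  · rw [Rp.p_dvd_iff]
    change WittVector.constantCoeff (x ^ p ^ N - x) = 0
    rw [map_sub, map_pow]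
    change (x.coeff 0) ^ p ^ N - x.coeff 0 = 0
    rw [h, sub_self]

end RFacts

section Generic
open Polynomial in
theorem Polynomial.eval_zero_derivative_prod {R κ : Type*} [CommRing R] (s : Finset κ) (b : κ → R)
    (e : κ → ℕ) :
    (derivative (∏ q ∈ s, (1 + C (b q) * X) ^ e q)).eval 0 = ∑ q ∈ s, e q * b q := by
  classical
  induction s using Finset.induction_on with
  | empty => simp
  | insert a s ha ih =>
    rw [Finset.prod_insert ha, Finset.sum_insert ha, derivative_mul]
    simp [ih, eval_prod, derivative_pow]

theorem MvPolynomial.eq_zero_of_aeval_affine_eq_zero {R σ : Type*} [CommRing R] [IsDomain R]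
    (a : σ → R) {c : R} (hc : c ≠ 0) (P : MvPolynomial σ R)
    (h : aeval (fun s ↦ C (a s) + C c * X s : σ → MvPolynomial σ R) P = 0) : P = 0 := by
  let K := FractionRing R
  let g : MvPolynomial σ R →ₐ[R] MvPolynomial σ K :=
    aeval fun s ↦ C (algebraMap R K c)⁻¹ * (X s - C (algebraMap R K (a s)))
  have hg : g.comp (aeval (fun s ↦ C (a s) + C c * X s : σ → MvPolynomial σ R)) =
      MvPolynomial.mapAlgHom (Algebra.ofId R K) := by
    ext1 s
    have hc' : (algebraMap R K c) ≠ 0 := by simpa using hc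
    have : (C (algebraMap R K c) * C (algebraMap R K c)⁻¹ : MvPolynomial σ K) = 1 := by
      rw [← C_mul, mul_inv_cancel₀ hc', C_1]
    simp only [AlgHom.comp_apply, aeval_X, map_add, map_mul, g, algHom_C, mapAlgHom_apply,
      map_X]
    simp only [IsScalarTower.algebraMap_apply R K (MvPolynomial σ K), algebraMap_eq]
    linear_combination (X s - C (algebraMap R K (a s))) * this
  have h2 := congrArg g h
  rw [← AlgHom.comp_apply, hg, map_zero] at h2
  apply MvPolynomial.map_injective (algebraMap R K) (IsFractionRing.injective R K)
  rw [map_zero, ← h2]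
  rfl

variable {p : ℕ} [Fact p.Prime] {ι : Type*}

theorem Rp.frob_pow_injective : Function.Injective fun m : ℕ ↦ (frobW p) ^ m := by
  have key : ∀ d : ℕ, (frobW p) ^ d = 1 → d = 0 := by
    intro d hd
    by_contra hd0
    have h : ∀ t : AlgebraicClosure (ZMod p), t ^ p ^ d = t := by
      intro t
      have h1 : ((frobW p) ^ d) (WittVector.teichmuller p t) = WittVector.teichmuller p t := by
        rw [hd]; rfl
      have h2 : ∀ d : ℕ, (((frobW p) ^ d) (WittVector.teichmuller p t)).coeff 0 = t ^ p ^ d := by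
        intro d
        induction d with
        | zero => simp
        | succ d ih =>
          rw [pow_succ', RingHom.mul_def, RingHom.comp_apply]
          rw [WittVector.coeff_frobenius_charP, ih, ← pow_mul, pow_succ]
      rw [← h2, h1, WittVector.teichmuller_coeff_zero]
    have hp := (Fact.out : p.Prime).one_lt
    have h0 := FiniteField.X_pow_card_pow_sub_X_ne_zero (AlgebraicClosure (ZMod p)) hd0 hp
    exact h0 (Polynomial.funext fun t ↦ by simp [h t])
  intro a b hab
  wlog hle : a ≤ b generalizing a b
  · exact (this hab.symm (le_of_not_ge hle)).symm
  obtain ⟨d, rfl⟩ := Nat.exists_eq_add_of_le hle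
  have : d = 0 := by
    apply key
    ext1 x
    have h1 : Function.Injective ((frobW p) ^ a) := by
      rw [RingHom.coe_pow]; exact Rp.frob_injective.iterate a
    apply h1
    have := congrArg (fun f : Rp p →+* Rp p ↦ f x) hab
    simp only [pow_add, RingHom.mul_def, RingHom.comp_apply] at this
    exact this.symm
  simp [this]

/-- The character `z ↦ φ^m (z i)` of `R^ι`. -/
def Rp.coordChar (q : ℕ × ι) : (ι → Rp p) →* Rp p :=
  (((frobW p) ^ q.1 : Rp p →+* Rp p) : Rp p →* Rp p).comp (Pi.evalMonoidHom _ q.2)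

theorem Rp.coordChar_apply (q : ℕ × ι) (z : ι → Rp p) :
    Rp.coordChar q z = ((frobW p) ^ q.1) (z q.2) := rfl

theorem Rp.coordChar_injective :
    Function.Injective (Rp.coordChar : ℕ × ι → ((ι → Rp p) →* Rp p)) := by
  classical
  rintro ⟨m, i⟩ ⟨m', i'⟩ h
  have h' : ∀ z : ι → Rp p, ((frobW p) ^ m) (z i) = ((frobW p) ^ m') (z i') :=
    fun z ↦ DFunLike.congr_fun h z
  have hi : i = i' := by
    by_contra hne
    have := h' (Function.update 1 i 0)
    rw [Function.update_self, Function.update_of_ne (Ne.symm hne)] at this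
    simp at this
  subst hi
  have : m = m' := Rp.frob_pow_injective (RingHom.ext fun w ↦ h' fun _ ↦ w)
  rw [this]

/-- The character of `R^ι` given by a monomial in the `φ^m (z i)`. -/
def Rp.monomialChar (e : ℕ × ι →₀ ℕ) : (ι → Rp p) →* Rp p :=
  ∏ q ∈ e.support, (Rp.coordChar (p := p) q) ^ e q

theorem Rp.monomialChar_apply (e : ℕ × ι →₀ ℕ) (z : ι → Rp p) :
    Rp.monomialChar e z = ∏ q ∈ e.support, (Rp.coordChar q z) ^ e q := by
  simp [Rp.monomialChar]

theorem Rp.monomialChar_injective :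
    Function.Injective (Rp.monomialChar : (ℕ × ι →₀ ℕ) → ((ι → Rp p) →* Rp p)) := by
  classical
  intro e f hef
  let s := e.support ∪ f.support
  have hs : ∀ g : ℕ × ι →₀ ℕ, g.support ⊆ s → ∀ z : ι → Rp p,
      Rp.monomialChar g z = ∏ q ∈ s, (Rp.coordChar q z) ^ g q := by
    intro g hg z
    rw [Rp.monomialChar_apply]
    refine Finset.prod_subset hg fun q _ hq ↦ ?_
    rw [Finsupp.notMem_support_iff.1 hq, pow_zero]
  have hsum : ∀ z : ι → Rp p, ∑ q ∈ s, (e q : Rp p) * Rp.coordChar q z =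
      ∑ q ∈ s, (f q : Rp p) * Rp.coordChar q z := by
    intro z
    rw [← Polynomial.eval_zero_derivative_prod, ← Polynomial.eval_zero_derivative_prod]
    congr 2
    apply Polynomial.eq_of_infinite_eval_eq
    refine (Set.infinite_range_of_injective (Nat.cast_injective (R := Rp p))).mono ?_
    rintro _ ⟨t, rfl⟩
    have h := DFunLike.congr_fun hef (fun i ↦ 1 + z i * t)
    rw [hs e Finset.subset_union_left, hs f Finset.subset_union_right] at h
    simpa [Polynomial.eval_prod, Rp.coordChar_apply, -RingHom.coe_pow] using h
  have hlin := (linearIndependent_monoidHom (ι → Rp p) (Rp p)).comp _ Rp.coordChar_injective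
  rw [linearIndependent_iff'] at hlin
  have h0 := hlin s (fun q ↦ (e q : Rp p) - f q) (by
    funext z
    simp [sub_mul, hsum z])
  ext q
  by_cases hq : q ∈ s
  · exact_mod_cast sub_eq_zero.1 (h0 q hq)
  · simp only [s, Finset.mem_union, Finsupp.mem_support_iff, not_or, not_not] at hq
    rw [hq.1, hq.2]

theorem Rp.exists_aeval_coordChar_ne_zero {Q : MvPolynomial (ℕ × ι) (Rp p)} (hQ : Q ≠ 0) :
    ∃ z : ι → Rp p, MvPolynomial.eval (fun q ↦ Rp.coordChar q z) Q ≠ 0 := by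
  by_contra! h
  have hlin := (linearIndependent_monoidHom (ι → Rp p) (Rp p)).comp _ Rp.monomialChar_injective
  rw [linearIndependent_iff'] at hlin
  have h0 := hlin Q.support (fun e ↦ Q.coeff e) (by
    funext z
    have := h z
    rw [MvPolynomial.eval_eq] at this
    simpa [Rp.monomialChar_apply] using this)
  refine hQ (MvPolynomial.ext _ _ fun e ↦ ?_)
  by_cases he : e ∈ Q.support
  · simpa using h0 e he
  · simpa using he

theorem Rp.exists_aeval_frob_ne_zero {P : MvPolynomial (ℕ × ι) ℤ} (hP : P ≠ 0) (a : ι → Rp p)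
    (N : ℕ) : ∃ z : ι → Rp p,
      MvPolynomial.aeval (fun q ↦ Rp.coordChar q (fun i ↦ a i + (p : Rp p) ^ N * z i)) P ≠ 0 := by
  let PR := MvPolynomial.map (Int.castRingHom (Rp p)) P
  have hPR : PR ≠ 0 := by
    intro h
    exact hP (MvPolynomial.map_injective _ (RingHom.injective_int _) (by rw [map_zero]; exact h))
  have hQ := mt (MvPolynomial.eq_zero_of_aeval_affine_eq_zero (fun q ↦ Rp.coordChar q a)
    (pow_ne_zero N Rp.p_ne_zero) PR) hPR
  obtain ⟨z, hz⟩ := Rp.exists_aeval_coordChar_ne_zero hQ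
  refine ⟨z, fun h ↦ hz ?_⟩
  rw [← h]
  have key : (MvPolynomial.eval fun q ↦ Rp.coordChar q z).comp
      ((MvPolynomial.aeval (fun q ↦ MvPolynomial.C (Rp.coordChar q a) +
        MvPolynomial.C ((p : Rp p) ^ N) * MvPolynomial.X q :
        ℕ × ι → MvPolynomial (ℕ × ι) (Rp p))).toRingHom.comp
        (MvPolynomial.map (Int.castRingHom (Rp p)))) =
      (MvPolynomial.aeval
        (fun q ↦ Rp.coordChar q (fun i ↦ a i + (p : Rp p) ^ N * z i))).toRingHom := by
    refine MvPolynomial.ringHom_ext' (RingHom.ext_int _ _) fun q ↦ ?_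
    simp [Rp.coordChar_apply, -RingHom.coe_pow]
  exact DFunLike.congr_fun key P

end Generic

section Topology
open Filter Topology
variable {p : ℕ} [Fact p.Prime] {n : ℕ}

instance Rp.instIsTopologicalRing : IsTopologicalRing (Rp p) :=
  ((Ideal.span {(p : Rp p)}).adic_basis.toRing_subgroups_basis).toRingFilterBasis.isTopologicalRing

theorem Rp.mem_nhds_zero_iff {s : Set (Rp p)} :
    s ∈ 𝓝 0 ↔ ∃ N : ℕ, ∀ x : Rp p, (p : Rp p) ^ N ∣ x → x ∈ s := by
  rw [((Ideal.span {(p : Rp p)}).hasBasis_nhds_zero_adic).mem_iff]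
  simp only [true_and, Set.subset_def, SetLike.mem_coe, Ideal.span_singleton_pow,
    Ideal.mem_span_singleton]

instance Rp.instT1Space : T1Space (Rp p) := by
  have h : IsClosed ({0} : Set (Rp p)) := by
    rw [← isOpen_compl_iff, isOpen_iff_mem_nhds]
    intro x hx
    obtain ⟨N, hN⟩ : ∃ N, ¬ (p : Rp p) ^ N ∣ x := by
      by_contra! h
      exact hx (Rp.eq_zero_of_forall_pow_dvd x h)
    rw [← map_add_left_nhds_zero x, mem_map, Rp.mem_nhds_zero_iff]
    refine ⟨N, fun y hy hxy ↦ hN ?_⟩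
    rw [Set.mem_singleton_iff] at hxy
    rw [eq_neg_of_add_eq_zero_left hxy]
    exact (dvd_neg).2 hy
  exact (IsTopologicalAddGroup.t1Space (Rp p) h)

theorem Rp.continuous_frob : Continuous (frobW p) := by
  refine continuous_of_continuousAt_zero _ ?_
  rw [ContinuousAt, map_zero]
  intro s hs
  obtain ⟨N, hN⟩ := Rp.mem_nhds_zero_iff.1 hs
  exact Rp.mem_nhds_zero_iff.2 ⟨N, fun x hx ↦ hN _ ((Rp.dvd_frob_iff N x).2 hx)⟩

/-- The space of invertible matrices congruent to `1` modulo `p`. -/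
abbrev Rp.Ball (p : ℕ) [Fact p.Prime] (n : ℕ) : Type _ :=
  {u : Matrix (Fin n) (Fin n) (Rp p) //
    IsUnit u ∧ ∀ i j, (p : Rp p) ∣ (u i j - (1 : Matrix (Fin n) (Fin n) (Rp p)) i j)}

/-- The family `φ^m (u i j)`. -/
def Rp.jet (u : Matrix (Fin n) (Fin n) (Rp p)) : ℕ × (Fin n × Fin n) → Rp p :=
  fun q ↦ Rp.coordChar q fun ij ↦ u ij.1 ij.2

theorem Rp.continuous_aeval_jet (P : MvPolynomial (ℕ × (Fin n × Fin n)) ℤ) :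
    Continuous fun u : Matrix (Fin n) (Fin n) (Rp p) ↦ MvPolynomial.aeval (Rp.jet u) P := by
  have hj : ∀ q, Continuous fun u : Matrix (Fin n) (Fin n) (Rp p) ↦ Rp.jet u q := by
    intro q
    simp only [Rp.jet, Rp.coordChar_apply, RingHom.coe_pow]
    exact (Rp.continuous_frob.iterate _).comp (by fun_prop)
  induction P using MvPolynomial.induction_on with
  | C a => simpa using continuous_const
  | add P Q hP hQ => simp only [map_add]; exact hP.add hQ
  | mul_X P q hP => simp only [map_mul, MvPolynomial.aeval_X]; exact hP.mul (hj q)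

theorem Rp.isNowhereDense_aeval_jet_eq_zero {P : MvPolynomial (ℕ × (Fin n × Fin n)) ℤ}
    (hP : P ≠ 0) :
    IsNowhereDense {u : Rp.Ball p n | MvPolynomial.aeval (Rp.jet u.1) P = 0} := by
  have hcl : IsClosed {u : Rp.Ball p n | MvPolynomial.aeval (Rp.jet u.1) P = 0} :=
    (isClosed_singleton (x := (0 : Rp p))).preimage
      ((Rp.continuous_aeval_jet P).comp continuous_subtype_val)
  refine (isClosed_isNowhereDense_iff_compl.2 ⟨hcl.isOpen_compl, fun u ↦ ?_⟩).2
  choose z hz using fun N : ℕ ↦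
    Rp.exists_aeval_frob_ne_zero (p := p) hP (fun ij ↦ u.1 ij.1 ij.2) (N + 1)
  let w : ℕ → Matrix (Fin n) (Fin n) (Rp p) :=
    fun N ↦ Matrix.of fun i j ↦ u.1 i j + (p : Rp p) ^ (N + 1) * z N (i, j)
  have hw : ∀ N i j,
      (p : Rp p) ∣ (w N i j - (1 : Matrix (Fin n) (Fin n) (Rp p)) i j) := by
    intro N i j
    have : w N i j - (1 : Matrix (Fin n) (Fin n) (Rp p)) i j =
      (u.1 i j - (1 : Matrix (Fin n) (Fin n) (Rp p)) i j) + p * (p ^ N * z N (i, j)) := by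
      simp only [w, Matrix.of_apply]; ring
    rw [this]
    exact (u.2.2 i j).add (dvd_mul_right _ _)
  let w' : ℕ → Rp.Ball p n := fun N ↦ ⟨w N, Rp.isUnit_matrix _ (hw N), hw N⟩
  refine mem_closure_of_tendsto (b := atTop) (f := w') ?_ (Eventually.of_forall fun N ↦ hz N)
  rw [tendsto_subtype_rng]
  refine tendsto_pi_nhds.2 fun i ↦ tendsto_pi_nhds.2 fun j ↦ ?_
  have : Tendsto (fun N ↦ (p : Rp p) ^ (N + 1) * z N (i, j)) atTop (𝓝 0) := by
    intro s hs
    obtain ⟨M, hM⟩ := Rp.mem_nhds_zero_iff.1 hs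
    refine mem_atTop_sets.2 ⟨M, fun N hN ↦ hM _ ?_⟩
    exact (pow_dvd_pow _ (hN.trans N.le_succ)).mul_right _
  simpa [w', w] using this.const_add (u.1 i j)

theorem Rp.isMeagre_not_algebraicIndependent_jet :
    IsMeagre {u : Rp.Ball p n | ¬ AlgebraicIndependent ℤ (Rp.jet u.1)} := by
  have : Countable (MvPolynomial (ℕ × (Fin n × Fin n)) ℤ) :=
    Cardinal.mk_le_aleph0_iff.1 (MvPolynomial.cardinalMk_le_max.trans
      (sup_le (sup_le (by simp) (Cardinal.mk_le_aleph0_iff.2 inferInstance)) le_rfl))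
  refine (isMeagre_iUnion (ι' := {P : MvPolynomial (ℕ × (Fin n × Fin n)) ℤ // P ≠ 0})
    fun P ↦ (Rp.isNowhereDense_aeval_jet_eq_zero (p := p) P.2).isMeagre).mono ?_
  intro u hu
  rw [Set.mem_ofPred_eq, algebraicIndependent_iff] at hu
  push Not at hu
  obtain ⟨P, hP, hP0⟩ := hu
  exact Set.mem_iUnion.2 ⟨⟨P, hP0⟩, hP⟩

end Topology

section Jets
variable {p : ℕ} [Fact p.Prime] {n : ℕ}

theorem Rp.jet_apply (u : Matrix (Fin n) (Fin n) (Rp p)) (m : ℕ) (i j : Fin n) :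
    Rp.jet u (m, i, j) = ((frobW p) ^ m) (u i j) := rfl

theorem Rp.frob_jet (u : Matrix (Fin n) (Fin n) (Rp p)) (q : ℕ × (Fin n × Fin n)) :
    frobW p (Rp.jet u q) = Rp.jet u (q.1 + 1, q.2) := by
  obtain ⟨m, i, j⟩ := q
  rw [Rp.jet_apply, Rp.jet_apply, pow_succ', RingHom.mul_def, RingHom.comp_apply]

theorem Rp.isUnit_map_pow {u : Matrix (Fin n) (Fin n) (Rp p)}
    (hu : ∀ i j, (p : Rp p) ∣ (u i j - (1 : Matrix (Fin n) (Fin n) (Rp p)) i j)) :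
    IsUnit (u.map (· ^ p)) := by
  refine Rp.isUnit_matrix _ fun i j ↦ (hu i j).trans ?_
  have h1 : (1 : Matrix (Fin n) (Fin n) (Rp p)) i j ^ p =
      (1 : Matrix (Fin n) (Fin n) (Rp p)) i j := by
    by_cases h : i = j <;> simp [Matrix.one_apply, h, (Fact.out : p.Prime).ne_zero]
  have h2 := sub_dvd_pow_sub_pow (u i j) ((1 : Matrix (Fin n) (Fin n) (Rp p)) i j) p
  rwa [h1] at h2

theorem Rp.jet_succ {u α : Matrix (Fin n) (Fin n) (Rp p)}
    (h : u.map (frobW p) = (1 + (p : Rp p) • α) * u.map (· ^ p)) (m : ℕ) (i j : Fin n) :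
    Rp.jet u (m + 1, i, j) = Rp.jet u (m, i, j) ^ p +
      p * ∑ k, Rp.jet α (m, i, k) * Rp.jet u (m, k, j) ^ p := by
  have h1 : frobW p (u i j) = u i j ^ p + p * ∑ k, α i k * u k j ^ p := by
    have := congrFun (congrFun h i) j
    rw [add_mul, one_mul, Matrix.smul_mul] at this
    simpa [Matrix.mul_apply] using this
  simp only [Rp.jet_apply, pow_succ, RingHom.mul_def, RingHom.comp_apply]
  simp [h1, -RingHom.coe_pow]

theorem Rp.jet_mem_adjoin {u α : Matrix (Fin n) (Fin n) (Rp p)}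
    (h : u.map (frobW p) = (1 + (p : Rp p) • α) * u.map (· ^ p)) {M : ℕ}
    {B : Subalgebra ℤ (Rp p)} (hu : ∀ i j, u i j ∈ B) (hα : ∀ m < M, ∀ i j, Rp.jet α (m, i, j) ∈ B)
    {m : ℕ} (hm : m ≤ M) (i j : Fin n) : Rp.jet u (m, i, j) ∈ B := by
  induction m generalizing i j with
  | zero => simpa [Rp.jet_apply] using hu i j
  | succ m ih =>
    rw [Rp.jet_succ h]
    have ih' := ih (m.le_succ.trans hm)
    exact B.add_mem (B.pow_mem (ih' i j) p) (B.mul_mem (natCast_mem B p)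
      (B.sum_mem fun k _ ↦ B.mul_mem (hα m hm i k) (B.pow_mem (ih' k j) p)))

theorem Rp.algebraicIndependent_adjoin_jet {u α : Matrix (Fin n) (Fin n) (Rp p)}
    (h : u.map (frobW p) = (1 + (p : Rp p) • α) * u.map (· ^ p))
    (hu : AlgebraicIndependent ℤ (Rp.jet u)) :
    AlgebraicIndependent (Algebra.adjoin ℤ (Set.range (Rp.jet α)))
      (fun ij : Fin n × Fin n ↦ u ij.1 ij.2) := by
  refine (AlgebraicIndependent.sumElim_iff.1 (?_ : AlgebraicIndependent ℤ
    (Sum.elim (fun ij : Fin n × Fin n ↦ u ij.1 ij.2) (Rp.jet α)))).2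
  refine algebraicIndependent_of_finite_type fun t ht ↦ ?_
  obtain ⟨M, hM⟩ : ∃ M, ∀ q : ℕ × (Fin n × Fin n), Sum.inr q ∈ t → q.1 < M := by
    obtain ⟨M, hM⟩ := (ht.image (Sum.elim (fun _ ↦ 0) Prod.fst)).bddAbove
    exact ⟨M + 1, fun q hq ↦ Nat.lt_succ_of_le (hM ⟨_, hq, rfl⟩)⟩
  let y : (Fin n × Fin n) ⊕ (Fin M × (Fin n × Fin n)) → Rp p :=
    Sum.elim (fun ij ↦ u ij.1 ij.2) fun q ↦ Rp.jet α (q.1, q.2)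
  have hy : AlgebraicIndependent ℤ y := by
    let x : Fin (M + 1) × (Fin n × Fin n) → Rp p := fun q ↦ Rp.jet u (q.1, q.2)
    have hx : AlgebraicIndependent ℤ x :=
      hu.comp (fun q : Fin (M + 1) × (Fin n × Fin n) ↦ ((q.1 : ℕ), q.2)) (by
        rintro ⟨a, b⟩ ⟨c, d⟩ hq
        simpa [Fin.ext_iff] using hq)
    refine hx.of_mem_adjoin_of_card_le (fun q ↦ ?_) ?_
    · refine Rp.jet_mem_adjoin h (M := M) (fun i j ↦ ?_) (fun m hm i j ↦ ?_)
        (Nat.le_of_lt_succ q.1.2) q.2.1 q.2.2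
      · exact Algebra.subset_adjoin ⟨Sum.inl (i, j), rfl⟩
      · exact Algebra.subset_adjoin ⟨Sum.inr (⟨m, hm⟩, i, j), rfl⟩
    · simp [Nat.card_eq_fintype_card, add_mul, add_comm]
  let f : t → (Fin n × Fin n) ⊕ (Fin M × (Fin n × Fin n)) := fun q ↦
    match q with
    | ⟨Sum.inl ij, _⟩ => Sum.inl ij
    | ⟨Sum.inr q, hq⟩ => Sum.inr (⟨q.1, hM q hq⟩, q.2)
  convert hy.comp f ?_ using 1
  · funext ⟨q, hq⟩
    cases q <;> rfl
  · rintro ⟨q | ⟨m, q⟩, hq⟩ ⟨r | ⟨l, r⟩, hr⟩ hqq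
    · simpa [f] using hqq
    · simp [f] at hqq
    · simp [f] at hqq
    · simpa [f] using hqq

/-- The elements of `R` algebraic over the subring generated by the `φ^m (α i j)`. -/
def Rp.algClosureJet (α : Matrix (Fin n) (Fin n) (Rp p)) : Subring (Rp p) :=
  (Subalgebra.algebraicClosure (Algebra.adjoin ℤ (Set.range (Rp.jet α))) (Rp p)).toSubring

theorem Rp.mem_algClosureJet {α : Matrix (Fin n) (Fin n) (Rp p)} {x : Rp p} :
    x ∈ Rp.algClosureJet α ↔ IsAlgebraic (Algebra.adjoin ℤ (Set.range (Rp.jet α))) x :=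
  Subalgebra.mem_algebraicClosure _ _

theorem Rp.mem_algClosureJet_self (α : Matrix (Fin n) (Fin n) (Rp p)) (i j : Fin n) :
    α i j ∈ Rp.algClosureJet α :=
  Rp.mem_algClosureJet.2 (isAlgebraic_algebraMap
    (⟨α i j, Algebra.subset_adjoin ⟨(0, i, j), rfl⟩⟩ :
      Algebra.adjoin ℤ (Set.range (Rp.jet α))))

theorem Rp.exists_subfield_algClosureJet (α : Matrix (Fin n) (Fin n) (Rp p)) :
    ∃ F : Subfield (Kp p),
      Rp.algClosureJet α = (F.toSubring).comap (algebraMap (Rp p) (Kp p)) := by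
  let A := Algebra.adjoin ℤ (Set.range (Rp.jet α))
  let F : Subfield (Kp p) :=
    { (Subalgebra.algebraicClosure A (Kp p)).toSubring with
      inv_mem' := fun x hx ↦ IsAlgebraic.inv_iff.2 hx }
  refine ⟨F, ?_⟩
  ext x
  rw [Rp.mem_algClosureJet]
  exact (isAlgebraic_algebraMap_iff (R := A) (IsFractionRing.injective (Rp p) (Kp p))).symm

theorem Rp.mem_algClosureJet_of_p_mul_mem {α : Matrix (Fin n) (Fin n) (Rp p)} {x : Rp p}
    (h : (p : Rp p) * x ∈ Rp.algClosureJet α) : x ∈ Rp.algClosureJet α := by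
  obtain ⟨F, hF⟩ := Rp.exists_subfield_algClosureJet α
  rw [hF] at h ⊢
  rw [Subring.mem_comap, map_mul, map_natCast] at h
  have hp : (p : Kp p) ≠ 0 := by
    rw [← map_natCast (algebraMap (Rp p) (Kp p))]
    exact (map_ne_zero_iff _ (IsFractionRing.injective (Rp p) (Kp p))).2 Rp.p_ne_zero
  rw [Subring.mem_comap, ← inv_mul_cancel_left₀ hp (algebraMap (Rp p) (Kp p) x)]
  exact F.mul_mem (F.inv_mem (natCast_mem F p)) h

theorem Rp.frob_mem_algClosureJet {α : Matrix (Fin n) (Fin n) (Rp p)} {x : Rp p}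
    (h : x ∈ Rp.algClosureJet α) : frobW p x ∈ Rp.algClosureJet α := by
  rw [Rp.mem_algClosureJet] at h ⊢
  let A := Algebra.adjoin ℤ (Set.range (Rp.jet α))
  have hA : ∀ a ∈ A, frobW p a ∈ A := by
    intro a ha
    have hle : A ≤ A.comap ((frobW p).toIntAlgHom) := by
      refine Algebra.adjoin_le ?_
      rintro _ ⟨q, rfl⟩
      refine Algebra.subset_adjoin (R := ℤ) ⟨(q.1 + 1, q.2), ?_⟩
      exact (Rp.frob_jet α q).symm
    exact hle ha
  let f : A →+* A := (frobW p).restrict A A hA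
  refine h.ringHom_of_comp_eq f (frobW p) (fun a b hab ↦ ?_) ?_
  · exact Subtype.ext (Rp.frob_injective (congrArg Subtype.val hab))
  · ext1 a
    rfl

end Jets

section Galois
variable {p : ℕ} [Fact p.Prime] {n : ℕ} {δ : Rp p → Rp p}

theorem Rp.delta_eq_zero_iff (hδ : ∀ a, frobW p a = a ^ p + p * δ a) (x : Rp p) :
    δ x = 0 ↔ frobW p x = x ^ p := by
  rw [hδ]
  simp [(Fact.out : p.Prime).ne_zero]

theorem Rp.delta_eq_zero_mem_algClosureJet (hδ : ∀ a, frobW p a = a ^ p + p * δ a)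
    (α : Matrix (Fin n) (Fin n) (Rp p)) {x : Rp p} (hx : δ x = 0) :
    x ∈ Rp.algClosureJet α := by
  obtain ⟨N, hN, h⟩ := Rp.exists_pow_eq_self ((Rp.delta_eq_zero_iff hδ x).1 hx)
  rw [Rp.mem_algClosureJet]
  have hint : IsAlgebraic ℤ x :=
    ⟨Polynomial.X ^ N - Polynomial.X, fun h0 ↦ by
      simpa [Polynomial.coeff_X_pow, (show 1 < N from hN).ne] using
        congrArg (Polynomial.coeff · 1) h0, by simp [h]⟩
  exact hint.extendScalars (RingHom.injective_int _)

theorem Rp.delta_mem_algClosureJet (hδ : ∀ a, frobW p a = a ^ p + p * δ a)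
    (α : Matrix (Fin n) (Fin n) (Rp p)) {x : Rp p} (hx : x ∈ Rp.algClosureJet α) :
    δ x ∈ Rp.algClosureJet α := by
  refine Rp.mem_algClosureJet_of_p_mul_mem ?_
  have h : (p : Rp p) * δ x = frobW p x - x ^ p := by rw [hδ]; ring
  rw [h]
  exact sub_mem (Rp.frob_mem_algClosureJet hx) (pow_mem hx p)

/-- If the entries of `u` are algebraically independent and `(u c)^(p) = u^(p) φ(c)`, then Frobenius
raises the entries of `c` to the `p`-th power and each column of `c` has at most one nonzero
entry. -/
theorem Rp.column_of_pow_eq {O : Subring (Rp p)} {u c : Matrix (Fin n) (Fin n) (Rp p)}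
    (hind : AlgebraicIndependent O (fun ij : Fin n × Fin n ↦ u ij.1 ij.2))
    (hc : ∀ i j, c i j ∈ O) (hfc : ∀ i j, frobW p (c i j) ∈ O)
    (h : (u * c).map (· ^ p) = u.map (· ^ p) * c.map (frobW p)) (k : Fin n) :
    (∀ j, frobW p (c j k) = c j k ^ p) ∧ ∀ j l, j ≠ l → c j k ≠ 0 → c l k = 0 := by
  have halg : ∀ a : O, algebraMap O (Rp p) a = a := fun _ ↦ rfl
  have hpoly : ((∑ j, MvPolynomial.X (k, j) * MvPolynomial.C ⟨c j k, hc j k⟩) ^ p :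
      MvPolynomial (Fin n × Fin n) O) =
      ∑ j, MvPolynomial.X (k, j) ^ p * MvPolynomial.C ⟨frobW p (c j k), hfc j k⟩ := by
    apply hind
    have := congrFun (congrFun h k) k
    simpa [Matrix.mul_apply, halg] using this
  have hp := (Fact.out : p.Prime)
  have h1 : ∀ j, frobW p (c j k) = c j k ^ p := by
    intro j
    have := congrArg (MvPolynomial.aeval fun ij : Fin n × Fin n ↦
      if ij.2 = j then (1 : Rp p) else 0) hpoly
    simpa [ite_pow, hp.ne_zero, eq_comm, halg] using this
  refine ⟨h1, fun j l hjl hj ↦ ?_⟩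
  have := congrArg (MvPolynomial.aeval fun ij : Fin n × Fin n ↦
      if ij.2 = j then (1 : Polynomial (Rp p)) else if ij.2 = l then Polynomial.X else 0) hpoly
  have h2 : ∀ (X : Polynomial (Rp p)) (f : Fin n → Polynomial (Rp p)),
      ∑ x, (if x = j then 1 else if x = l then X else 0) * f x = f j + X * f l := by
    intro X f
    have : ∀ x, (if x = j then 1 else if x = l then X else 0) * f x =
        (if x = j then f x else 0) + if x = l then X * f x else 0 := by
      intro x
      by_cases hx : x = j
      · subst hx; simp [hjl]
      · by_cases hx' : x = l
        · subst hx'; simp [hx]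
        · simp [hx, hx']
    simp [this, Finset.sum_add_distrib]
  simp only [map_pow, map_sum, map_mul, MvPolynomial.aeval_X, MvPolynomial.algHom_C, ite_pow,
    one_pow, zero_pow hp.ne_zero, h2] at this
  have h3 := congrArg (fun P : Polynomial (Rp p) ↦ (Polynomial.derivative P).eval 0) this
  simp only [IsScalarTower.algebraMap_apply O (Rp p) (Polynomial (Rp p)),
    Polynomial.algebraMap_eq, halg] at h3
  have hp1 : p - 1 ≠ 0 := Nat.sub_ne_zero_of_lt hp.one_lt
  simp [Polynomial.derivative_pow, hp1] at h3
  exact h3.resolve_left fun h0 ↦ h0.elim hp.ne_zero hj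

theorem Matrix.exists_perm_of_mul_eq_one {R : Type*} [CommRing R] [IsDomain R]
    {c d : Matrix (Fin n) (Fin n) R} (hcd : c * d = 1) (hdc : d * c = 1)
    (h : ∀ k j l, j ≠ l → c j k ≠ 0 → c l k = 0) :
    ∃ τ : Equiv.Perm (Fin n), (∀ i j, i ≠ τ j → c i j = 0) ∧ ∀ j, c (τ j) j ≠ 0 := by
  have hcol : ∀ k, ∃ j, c j k ≠ 0 := by
    intro k
    by_contra! h0
    have := congrFun (congrFun hdc k) k
    simp [Matrix.mul_apply, h0] at this
  have hrow : ∀ j, ∃ k, c j k ≠ 0 := by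
    intro k
    by_contra! h0
    have := congrFun (congrFun hcd k) k
    simp [Matrix.mul_apply, h0] at this
  choose τ hτ using hcol
  have hτ' : ∀ i j, i ≠ τ j → c i j = 0 := fun i j hij ↦ h j (τ j) i hij.symm (hτ j)
  have hsurj : Function.Surjective τ := by
    intro j
    obtain ⟨k, hk⟩ := hrow j
    refine ⟨k, ?_⟩
    by_contra hne
    exact hk (hτ' j k (Ne.symm hne))
  exact ⟨Equiv.ofBijective τ (Finite.surjective_iff_bijective.1 hsurj), hτ', hτ⟩

/-- `O[u]` is a polynomial ring when the entries of `u` are algebraically independent over `O`. -/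
def Rp.genByEquiv {O : Subring (Rp p)} {u : Matrix (Fin n) (Fin n) (Rp p)}
    (hind : AlgebraicIndependent O (fun ij : Fin n × Fin n ↦ u ij.1 ij.2)) :
    MvPolynomial (Fin n × Fin n) O ≃+* genBy O u :=
  RingEquiv.ofBijective
    ((MvPolynomial.aeval (R := O) (fun ij : Fin n × Fin n ↦ u ij.1 ij.2)).toRingHom.codRestrict
      (genBy O u) (fun P ↦ by
        induction P using MvPolynomial.induction_on with
        | C a =>
          refine Subring.subset_closure (Or.inl ?_)
          have h : MvPolynomial.aeval (R := O) (fun ij : Fin n × Fin n ↦ u ij.1 ij.2)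
              (MvPolynomial.C a) = (a : Rp p) := MvPolynomial.algHom_C _ a
          exact h ▸ a.2
        | add P Q hP hQ => rw [map_add]; exact add_mem hP hQ
        | mul_X P q hP =>
          rw [map_mul]
          refine mul_mem hP ?_
          simpa using mem_genBy O u q.1 q.2))
    ⟨fun P Q h ↦ hind (congrArg Subtype.val h), by
      have hle : genBy O u ≤
          (MvPolynomial.aeval (R := O) (fun ij : Fin n × Fin n ↦ u ij.1 ij.2)).toRingHom.range := by
        refine Subring.closure_le.2 ?_
        rintro x (hx | ⟨i, j, rfl⟩)
        · exact ⟨MvPolynomial.C ⟨x, hx⟩, MvPolynomial.algHom_C _ _⟩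
        · exact ⟨MvPolynomial.X (i, j), by simp⟩
      rintro ⟨x, hx⟩
      obtain ⟨P, hP⟩ := hle hx
      exact ⟨P, Subtype.ext hP⟩⟩

theorem Rp.genByEquiv_coe {O : Subring (Rp p)} {u : Matrix (Fin n) (Fin n) (Rp p)}
    (hind : AlgebraicIndependent O (fun ij : Fin n × Fin n ↦ u ij.1 ij.2))
    (P : MvPolynomial (Fin n × Fin n) O) :
    (Rp.genByEquiv hind P : Rp p) =
      MvPolynomial.aeval (R := O) (fun ij : Fin n × Fin n ↦ u ij.1 ij.2) P := rfl

/-- The substitution `X ↦ X * c`. -/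
def Rp.substHom {O : Type*} [CommRing O] (c : Matrix (Fin n) (Fin n) O) :
    MvPolynomial (Fin n × Fin n) O →ₐ[O] MvPolynomial (Fin n × Fin n) O :=
  MvPolynomial.aeval fun ij ↦ ∑ k, MvPolynomial.X (ij.1, k) * MvPolynomial.C (c k ij.2)

theorem Rp.substHom_X {O : Type*} [CommRing O] (c : Matrix (Fin n) (Fin n) O) (i j : Fin n) :
    Rp.substHom c (MvPolynomial.X (i, j)) =
      ∑ k, MvPolynomial.X (i, k) * MvPolynomial.C (c k j) := by
  simp [Rp.substHom]

theorem Rp.substHom_comp {O : Type*} [CommRing O] {c d : Matrix (Fin n) (Fin n) O}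
    (h : c * d = 1) : (Rp.substHom c).comp (Rp.substHom d) = AlgHom.id O _ := by
  refine MvPolynomial.algHom_ext fun ⟨i, j⟩ ↦ ?_
  have h' : ∀ l, ∑ k, c l k * d k j = (1 : Matrix (Fin n) (Fin n) O) l j := fun l ↦ by
    rw [← h, Matrix.mul_apply]
  rw [AlgHom.comp_apply, Rp.substHom_X]
  simp only [map_sum, map_mul, Rp.substHom_X, Finset.sum_mul, MvPolynomial.algHom_C,
    MvPolynomial.algebraMap_eq, mul_assoc]
  rw [Finset.sum_comm]
  simp only [← Finset.mul_sum, ← MvPolynomial.C_mul, ← map_sum, h']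
  simp [Matrix.one_apply]

/-- The substitution `X ↦ X * c` as an automorphism. -/
def Rp.substEquiv {O : Type*} [CommRing O] (c d : Matrix (Fin n) (Fin n) O)
    (h : c * d = 1) (h' : d * c = 1) :
    MvPolynomial (Fin n × Fin n) O ≃ₐ[O] MvPolynomial (Fin n × Fin n) O :=
  AlgEquiv.ofAlgHom (Rp.substHom c) (Rp.substHom d) (Rp.substHom_comp h) (Rp.substHom_comp h')

theorem Rp.map_frob_eq (hδ : ∀ a, frobW p a = a ^ p + p * δ a)
    {v α : Matrix (Fin n) (Fin n) (Rp p)} (h : v.map δ = α * v.map (· ^ p)) :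
    v.map (frobW p) = (1 + (p : Rp p) • α) * v.map (· ^ p) := by
  rw [add_mul, one_mul, Matrix.smul_mul, ← h]
  refine Matrix.ext fun i j ↦ ?_
  simp [hδ]

theorem Rp.galoisGroup_subset (hδ : ∀ a, frobW p a = a ^ p + p * δ a) {O : Subring (Rp p)}
    {u α : Matrix (Fin n) (Fin n) (Rp p)}
    (hind : AlgebraicIndependent O (fun ij : Fin n × Fin n ↦ u ij.1 ij.2))
    (hφ : ∀ x ∈ O, frobW p x ∈ O) (hα : ∀ i j, α i j ∈ O) (h : u.map δ = α * u.map (· ^ p)) :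
    galoisGroup δ O u ⊆ {c | ∃ τ : Equiv.Perm (Fin n),
      (∀ i j, i ≠ τ j → c i j = 0) ∧ (∀ j, c (τ j) j ≠ 0 ∧ δ (c (τ j) j) = 0)} := by
  rintro c ⟨hc, ⟨d, hcd, hdc, -⟩, σ, hσO, hσδ, hσu⟩
  have hδuc : (u * c).map δ = α * (u * c).map (· ^ p) := by
    refine Matrix.ext fun i j ↦ ?_
    have hmem : ∀ i j, α i j ∈ genBy O u := fun i j ↦ Subring.subset_closure (Or.inl (hα i j))
    let y : genBy O u := ∑ k, ⟨α i k, hmem i k⟩ * ⟨u k j, mem_genBy O u k j⟩ ^ p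
    have hy : (y : Rp p) = δ (u i j) := by
      have := congrFun (congrFun h i) j
      simp only [Matrix.map_apply, Matrix.mul_apply] at this
      rw [this]
      simp [y]
    have hσy := hσδ ⟨u i j, mem_genBy O u i j⟩ y hy
    rw [hσu] at hσy
    rw [Matrix.map_apply, ← hσy]
    have hσα : ∀ k, (σ ⟨α i k, hmem i k⟩ : Rp p) = α i k := fun k ↦ hσO _ (hα i k)
    simp only [y, map_sum, map_mul, map_pow, AddSubmonoidClass.coe_finsetSum, MulMemClass.coe_mul,
      SubmonoidClass.coe_pow, hσα, hσu, Matrix.mul_apply (M := α), Matrix.map_apply]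
  have hunit : IsUnit (1 + (p : Rp p) • α) := Rp.isUnit_matrix _ fun i j ↦ by simp
  have hpow : (u * c).map (· ^ p) = u.map (· ^ p) * c.map (frobW p) := by
    refine hunit.mul_left_cancel ?_
    rw [← Rp.map_frob_eq hδ hδuc, Matrix.map_mul, Rp.map_frob_eq hδ h, mul_assoc]
  have hcol := Rp.column_of_pow_eq hind hc (fun i j ↦ hφ _ (hc i j)) hpow
  obtain ⟨τ, hτ, hτ'⟩ := Matrix.exists_perm_of_mul_eq_one hcd hdc fun k ↦ (hcol k).2
  exact ⟨τ, hτ, fun j ↦ ⟨hτ' j, (Rp.delta_eq_zero_iff hδ _).2 ((hcol j).1 _)⟩⟩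

/-- A Frobenius lift on polynomials compatible with evaluation at every solution `v`
of `φ(v) = (1 + p α) v^(p)`. -/
theorem Rp.exists_frob_aeval {O : Subring (Rp p)} {α : Matrix (Fin n) (Fin n) (Rp p)}
    (hφ : ∀ x ∈ O, frobW p x ∈ O) (hα : ∀ i j, α i j ∈ O) :
    ∃ Φ : MvPolynomial (Fin n × Fin n) O → MvPolynomial (Fin n × Fin n) O,
      ∀ v : Matrix (Fin n) (Fin n) (Rp p),
        v.map (frobW p) = (1 + (p : Rp p) • α) * v.map (· ^ p) →
        ∀ P, frobW p (MvPolynomial.aeval (fun ij : Fin n × Fin n ↦ v ij.1 ij.2) P) =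
          MvPolynomial.aeval (fun ij : Fin n × Fin n ↦ v ij.1 ij.2) (Φ P) := by
  let φO : O →+* O := (frobW p).restrict O O hφ
  let Φ : MvPolynomial (Fin n × Fin n) O →+* MvPolynomial (Fin n × Fin n) O :=
    MvPolynomial.eval₂Hom (MvPolynomial.C.comp φO) fun ij ↦ MvPolynomial.X ij ^ p +
      (p : MvPolynomial (Fin n × Fin n) O) *
        ∑ k, MvPolynomial.C ⟨α ij.1 k, hα ij.1 k⟩ * MvPolynomial.X (k, ij.2) ^ p
  refine ⟨Φ, fun v hv P ↦ ?_⟩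
  let E : MvPolynomial (Fin n × Fin n) O →+* Rp p :=
    (MvPolynomial.aeval (R := O) fun ij : Fin n × Fin n ↦ v ij.1 ij.2).toRingHom
  have hE : ∀ a : O, E (MvPolynomial.C a) = a := fun a ↦ MvPolynomial.algHom_C _ a
  have hX : ∀ i j, E (MvPolynomial.X (i, j)) = v i j := fun i j ↦ MvPolynomial.aeval_X _ _
  have hv' : ∀ i j, frobW p (v i j) = v i j ^ p + p * ∑ k, α i k * v k j ^ p := by
    intro i j
    have := congrFun (congrFun hv i) j
    rw [add_mul, one_mul, Matrix.smul_mul] at this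
    simpa [Matrix.mul_apply] using this
  have key : (frobW p).comp E = E.comp Φ := by
    refine MvPolynomial.ringHom_ext (fun a ↦ ?_) fun ⟨i, j⟩ ↦ ?_
    · simp only [RingHom.comp_apply, hE, Φ, MvPolynomial.eval₂Hom_C]
      rfl
    · simp only [RingHom.comp_apply, hE, hX, Φ, MvPolynomial.eval₂Hom_X', map_add, map_mul,
        map_pow, map_sum, map_natCast, hv']
  exact RingHom.congr_fun key P

theorem Rp.mem_galoisGroup_of_monomial (hδ : ∀ a, frobW p a = a ^ p + p * δ a)
    {O : Subring (Rp p)} {u α c : Matrix (Fin n) (Fin n) (Rp p)}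
    (hind : AlgebraicIndependent O (fun ij : Fin n × Fin n ↦ u ij.1 ij.2))
    (hφ : ∀ x ∈ O, frobW p x ∈ O) (hα : ∀ i j, α i j ∈ O) (h : u.map δ = α * u.map (· ^ p))
    (hO : ∀ x, δ x = 0 → x ∈ O) {τ : Equiv.Perm (Fin n)} (hτ : ∀ i j, i ≠ τ j → c i j = 0)
    (hτ' : ∀ j, c (τ j) j ≠ 0 ∧ δ (c (τ j) j) = 0) : c ∈ galoisGroup δ O u := by
  have hp := (Fact.out : p.Prime)
  have hcfrob : ∀ i j, frobW p (c i j) = c i j ^ p := by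
    intro i j
    by_cases hij : i = τ j
    · rw [hij]
      exact (Rp.delta_eq_zero_iff hδ _).1 (hτ' j).2
    · simp [hτ i j hij, hp.ne_zero]
  have hc : ∀ i j, c i j ∈ O := fun i j ↦ hO _ ((Rp.delta_eq_zero_iff hδ _).2 (hcfrob i j))
  obtain ⟨ζ, hζ, hζO⟩ : ∃ ζ : Fin n → Rp p, (∀ j, c (τ j) j * ζ j = 1) ∧ ∀ j, ζ j ∈ O := by
    have : ∀ j, ∃ z ∈ O, c (τ j) j * z = 1 := by
      intro j
      obtain ⟨N, hN, hpow⟩ := Rp.exists_pow_eq_self (hcfrob (τ j) j)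
      refine ⟨c (τ j) j ^ (N - 2), pow_mem (hc _ _) _, mul_left_cancel₀ (hτ' j).1 ?_⟩
      rw [mul_one, ← pow_succ', ← pow_succ', show N - 2 + 1 + 1 = N by omega, hpow]
    choose ζ h1 h2 using this
    exact ⟨ζ, h2, h1⟩
  let d : Matrix (Fin n) (Fin n) (Rp p) := Matrix.of fun j i ↦ if i = τ j then ζ j else 0
  have hdO : ∀ i j, d i j ∈ O := fun i j ↦ by
    by_cases hij : j = τ i
    · simpa [d, hij] using hζO i
    · simp [d, hij, zero_mem]
  have hdc : d * c = 1 := by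
    refine Matrix.ext fun i j ↦ ?_
    rw [Matrix.mul_apply, Finset.sum_eq_single (τ i) (fun k _ hk ↦ by simp [d, hk]) (by simp)]
    by_cases hij : i = j
    · subst hij
      simpa [d, mul_comm] using hζ i
    · rw [hτ (τ i) j (by simpa using hij), mul_zero, Matrix.one_apply_ne hij]
  have hcd : c * d = 1 := mul_eq_one_comm.1 hdc
  refine ⟨hc, ⟨d, hcd, hdc, hdO⟩, ?_⟩
  let cO : Matrix (Fin n) (Fin n) O := Matrix.of fun i j ↦ ⟨c i j, hc i j⟩
  let dO : Matrix (Fin n) (Fin n) O := Matrix.of fun i j ↦ ⟨d i j, hdO i j⟩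
  have hcdO : cO * dO = 1 := by
    refine Matrix.ext fun i j ↦ Subtype.ext ?_
    have := congrFun (congrFun hcd i) j
    by_cases hij : i = j <;> simpa [Matrix.mul_apply, cO, dO, Matrix.one_apply, hij] using this
  have hdcO : dO * cO = 1 := mul_eq_one_comm.1 hcdO
  let e := Rp.genByEquiv hind
  let σ : genBy O u ≃+* genBy O u :=
    (e.symm.trans (Rp.substEquiv cO dO hcdO hdcO).toRingEquiv).trans e
  have halg : ∀ a : O, algebraMap O (Rp p) a = a := fun _ ↦ rfl
  have he : ∀ P, (e P : Rp p) =
      MvPolynomial.aeval (R := O) (fun ij : Fin n × Fin n ↦ u ij.1 ij.2) P :=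
    Rp.genByEquiv_coe hind
  have hσ : ∀ P, (σ (e P) : Rp p) =
      MvPolynomial.aeval (fun ij : Fin n × Fin n ↦ (u * c) ij.1 ij.2) P := by
    intro P
    have h1 : (σ (e P) : Rp p) = MvPolynomial.aeval (R := O)
        (fun ij : Fin n × Fin n ↦ u ij.1 ij.2) (Rp.substHom cO P) := by
      simp only [σ, RingEquiv.trans_apply, RingEquiv.symm_apply_apply]
      rfl
    rw [h1, ← AlgHom.comp_apply]
    congr 1
    refine MvPolynomial.algHom_ext fun ⟨i, j⟩ ↦ ?_
    simp [Rp.substHom_X, Matrix.mul_apply, cO, halg]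
  have hu := Rp.map_frob_eq hδ h
  have huc : (u * c).map (frobW p) = (1 + (p : Rp p) • α) * (u * c).map (· ^ p) := by
    have hsum : ∀ i j, (u * c) i j = u i (τ j) * c (τ j) j := fun i j ↦ by
      rw [Matrix.mul_apply, Finset.sum_eq_single (τ j) (fun k _ hk ↦ by simp [hτ k j hk]) (by simp)]
    have hpow : (u * c).map (· ^ p) = u.map (· ^ p) * c.map (frobW p) := by
      refine Matrix.ext fun i j ↦ ?_
      rw [Matrix.mul_apply, Finset.sum_eq_single (τ j) (fun k _ hk ↦ by simp [hτ k j hk]) (by simp)]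
      simp only [Matrix.map_apply, hsum, mul_pow, hcfrob]
    rw [Matrix.map_mul, hu, hpow, mul_assoc]
  obtain ⟨Φ, hΦ⟩ := Rp.exists_frob_aeval hφ hα
  refine ⟨σ, fun x hx ↦ ?_, fun x y hxy ↦ ?_, fun i j ↦ ?_⟩
  · have hxe : x = e (MvPolynomial.C ⟨x, hx⟩) := Subtype.ext <| by
      rw [he, MvPolynomial.algHom_C, halg]
    have hσx := hσ (MvPolynomial.C ⟨x, hx⟩)
    rwa [← hxe, MvPolynomial.algHom_C, halg] at hσx
  · obtain ⟨P, rfl⟩ := e.surjective x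
    obtain ⟨Q, rfl⟩ := e.surjective y
    have hQ : (p : MvPolynomial (Fin n × Fin n) O) * Q = Φ P - P ^ p := by
      apply hind
      rw [map_mul, map_sub, map_pow, map_natCast, ← hΦ u hu]
      change (p : Rp p) * (e Q : Rp p) = frobW p (e P : Rp p) - (e P : Rp p) ^ p
      rw [hxy, hδ (e P : Rp p), add_sub_cancel_left]
    have hQ' := congrArg
      (MvPolynomial.aeval (fun ij : Fin n × Fin n ↦ (u * c) ij.1 ij.2)) hQ
    rw [map_mul, map_sub, map_pow, map_natCast, ← hΦ _ huc, ← hσ, ← hσ, hδ,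
      add_sub_cancel_left] at hQ'
    exact mul_left_cancel₀ Rp.p_ne_zero hQ'
  · have hxe : (⟨u i j, mem_genBy O u i j⟩ : genBy O u) = e (MvPolynomial.X (i, j)) :=
      Subtype.ext <| by rw [he, MvPolynomial.aeval_X]
    rw [hxe, hσ, MvPolynomial.aeval_X]

end Galois

/-- outside a meagre subset of `X = {u ∈ GL_n(R) : u ≡ 1 mod p}`,
setting `α := δu·(u^(p))⁻¹`, there is a valuation `δ`-subring `O` of `R` containing
`R^δ` and the entries of `α` with `G_{u/O} = N^δ`. -/
theorem statement17 {p : ℕ} [Fact p.Prime] (hp2 : p ≠ 2)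
    (δ : Rp p → Rp p) (hδ : ∀ a, frobW p a = a ^ p + p * δ a)
    (n : ℕ) (hn : 1 ≤ n) :
    ∃ Ω : Set {u : Matrix (Fin n) (Fin n) (Rp p) //
        IsUnit u ∧ ∀ i j, (p : Rp p) ∣ (u i j - (1 : Matrix (Fin n) (Fin n) (Rp p)) i j)},
      IsMeagre Ω ∧
      ∀ u : {u : Matrix (Fin n) (Fin n) (Rp p) //
          IsUnit u ∧ ∀ i j, (p : Rp p) ∣ (u i j - (1 : Matrix (Fin n) (Fin n) (Rp p)) i j)},
        u ∉ Ω →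
        IsUnit ((u : Matrix (Fin n) (Fin n) (Rp p)).map (· ^ p)) ∧
        ∃ O : Subring (Rp p),
          (∀ x ∈ O, δ x ∈ O) ∧
          (∃ F : Subfield (Kp p),
            O = (F.toSubring).comap (algebraMap (Rp p) (Kp p))) ∧
          (∀ x : Rp p, δ x = 0 → x ∈ O) ∧
          (∀ i j, (((u : Matrix (Fin n) (Fin n) (Rp p)).map δ) *
            ((u : Matrix (Fin n) (Fin n) (Rp p)).map (· ^ p))⁻¹) i j ∈ O) ∧
          galoisGroup δ O (u : Matrix (Fin n) (Fin n) (Rp p)) =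
            {c | ∃ τ : Equiv.Perm (Fin n),
              (∀ i j, i ≠ τ j → c i j = 0) ∧
              (∀ j, c (τ j) j ≠ 0 ∧ δ (c (τ j) j) = 0)} := by
  refine ⟨{u : Rp.Ball p n | ¬ AlgebraicIndependent ℤ (Rp.jet u.1)},
    Rp.isMeagre_not_algebraicIndependent_jet, ?_⟩
  rintro ⟨u, hunit, hu⟩ hgen
  have hjet : AlgebraicIndependent ℤ (Rp.jet u) := not_not.1 hgen
  have hup : IsUnit (u.map (· ^ p)) := Rp.isUnit_map_pow hu
  refine ⟨hup, ?_⟩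
  let α := u.map δ * (u.map (· ^ p))⁻¹
  have h : u.map δ = α * u.map (· ^ p) := by
    rw [mul_assoc, Matrix.nonsing_inv_mul _ ((Matrix.isUnit_iff_isUnit_det _).1 hup), mul_one]
  have hα : ∀ i j, α i j ∈ Rp.algClosureJet α := fun i j ↦ Rp.mem_algClosureJet_self α i j
  have hind : AlgebraicIndependent (Rp.algClosureJet α)
      (fun ij : Fin n × Fin n ↦ u ij.1 ij.2) :=
    (Rp.algebraicIndependent_adjoin_jet (Rp.map_frob_eq hδ h) hjet).subalgebraAlgebraicClosure
  have hO : ∀ x : Rp p, δ x = 0 → x ∈ Rp.algClosureJet α := fun x hx ↦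
    Rp.delta_eq_zero_mem_algClosureJet hδ α hx
  have hφ : ∀ x ∈ Rp.algClosureJet α, frobW p x ∈ Rp.algClosureJet α := fun x hx ↦
    Rp.frob_mem_algClosureJet hx
  refine ⟨Rp.algClosureJet α, fun x hx ↦ Rp.delta_mem_algClosureJet hδ α hx,
    Rp.exists_subfield_algClosureJet α, hO, hα,
    (Rp.galoisGroup_subset hδ hind hφ hα h).antisymm ?_⟩
  rintro c ⟨τ, hτ, hτ'⟩
  exact Rp.mem_galoisGroup_of_monomial hδ hind hφ hα h hO hτ hτ'
end
end
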